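/- arXiv:2604.00129 — 3 statements merged into one kernel-verified Lean document; each statement's English description precedes it below -/
import Mathlib

section
/- Suppose (i,j) ∈ M*(b,s) for some bid profile (b,s). Then for any bid s'_j < s_j of seller j, the pair (i,j) is also contained in the maximum-weight matching for the profile (b, (s'_j, s_{-j})); that is, (i,j) ∈ M*(b, (s'_j, s_{-j})). -/
open Finset

noncomputable section

/-- The weight of a set of buyer–seller edges `M` under buyer bids `b` and seller bids `s`:
`∑_{(i,j)∈M} (b i − s j)`. -/
def matchWeight {m n : ℕ} (b : Fin m → ℝ) (s : Fin n → ℝ)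
    (M : Finset (Fin m × Fin n)) : ℝ :=
  ∑ e ∈ M, (b e.1 - s e.2)

/-- A set of edges is a matching: no two distinct edges share a buyer or share a seller. -/
def IsMatching {m n : ℕ} (M : Finset (Fin m × Fin n)) : Prop :=
  ∀ e ∈ M, ∀ e' ∈ M, e ≠ e' → e.1 ≠ e'.1 ∧ e.2 ≠ e'.2

/-- A two-sided matching market with `m` buyers and `n` sellers: a finite edge set `E`,
a nonempty downward-closed family `Fam` of matchings contained in `E`, a fixed strict
linear tie-breaking order `tb` on `Fam`, and the selection `Mstar b s` of the `tb`-least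
maximum-weight member of `Fam`. -/
structure MarketSetup (m n : ℕ) where
  E : Finset (Fin m × Fin n)
  Fam : Finset (Finset (Fin m × Fin n))
  tb : Finset (Fin m × Fin n) → Finset (Fin m × Fin n) → Prop
  Mstar : (Fin m → ℝ) → (Fin n → ℝ) → Finset (Fin m × Fin n)
  empty_mem : ∅ ∈ Fam
  subset_E : ∀ M ∈ Fam, M ⊆ E
  matching : ∀ M ∈ Fam, IsMatching M
  downward_closed : ∀ M ∈ Fam, ∀ M' ⊆ M, M' ∈ Fam
  tb_irrefl : ∀ M ∈ Fam, ¬ tb M M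
  tb_trans : ∀ M₁ ∈ Fam, ∀ M₂ ∈ Fam, ∀ M₃ ∈ Fam, tb M₁ M₂ → tb M₂ M₃ → tb M₁ M₃
  tb_total : ∀ M₁ ∈ Fam, ∀ M₂ ∈ Fam, M₁ ≠ M₂ → tb M₁ M₂ ∨ tb M₂ M₁
  Mstar_mem : ∀ b s, Mstar b s ∈ Fam
  Mstar_max : ∀ b s, ∀ M ∈ Fam, matchWeight b s M ≤ matchWeight b s (Mstar b s)
  Mstar_lt : ∀ b s, ∀ M ∈ Fam,
      matchWeight b s M = matchWeight b s (Mstar b s) → M ≠ Mstar b s →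
      tb (Mstar b s) M

/-- Changing the bid of seller `j` to `s'` shifts the weight of `M` by `s j - s'` for every edge
of `M` at `j`. -/
theorem matchWeight_update {m n : ℕ} (b : Fin m → ℝ) (s : Fin n → ℝ) (j : Fin n) (s' : ℝ)
    (M : Finset (Fin m × Fin n)) :
    matchWeight b (Function.update s j s') M =
      matchWeight b s M + #{e ∈ M | e.2 = j} * (s j - s') := by
  rw [← nsmul_eq_mul, ← Finset.sum_const, Finset.sum_filter, matchWeight, matchWeight,
    ← Finset.sum_add_distrib]
  refine Finset.sum_congr rfl fun e _ => ?_
  by_cases h : e.2 = j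
  · simp [h]
  · simp [h]

theorem IsMatching.card_filter_seller_le_one {m n : ℕ} {M : Finset (Fin m × Fin n)}
    (hM : IsMatching M) (j : Fin n) : #{e ∈ M | e.2 = j} ≤ 1 := by
  refine Finset.card_le_one.2 fun e he e' he' => ?_
  rw [Finset.mem_filter] at he he'
  by_contra hne
  exact (hM e he.1 e' he'.1 hne).2 (he.2.trans he'.2.symm)

/-- If `(i,j) ∈ M*(b,s)`, then for any bid `s'ⱼ < sⱼ` of seller `j`,
`(i,j) ∈ M*(b, (s'ⱼ, s₋ⱼ))`. -/
theorem mwm_monotone_seller {m n : ℕ} (mk : MarketSetup m n)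
    (b : Fin m → ℝ) (s : Fin n → ℝ) (i : Fin m) (j : Fin n)
    (hij : (i, j) ∈ mk.Mstar b s)
    (s' : ℝ) (hs' : s' < s j) :
    (i, j) ∈ mk.Mstar b (Function.update s j s') := by
  set M := mk.Mstar b s
  set M' := mk.Mstar b (Function.update s j s')
  have hMF : M ∈ mk.Fam := mk.Mstar_mem _ _
  have hMF' : M' ∈ mk.Fam := mk.Mstar_mem _ _
  have h₁ : matchWeight b s M' ≤ matchWeight b s M := mk.Mstar_max b s M' hMF'
  have h₂ : matchWeight b (Function.update s j s') M ≤
      matchWeight b (Function.update s j s') M' := mk.Mstar_max _ _ M hMF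
  have hup := matchWeight_update b s j s' M
  have hup' := matchWeight_update b s j s' M'
  have hc : (1 : ℝ) ≤ #{e ∈ M | e.2 = j} := by
    have : 1 ≤ #{e ∈ M | e.2 = j} :=
      Finset.one_le_card.2 ⟨(i, j), Finset.mem_filter.2 ⟨hij, rfl⟩⟩
    exact_mod_cast this
  have hc' : (#{e ∈ M' | e.2 = j} : ℝ) ≤ 1 := by
    exact_mod_cast (mk.matching M' hMF').card_filter_seller_le_one j
  have hshift : (#{e ∈ M' | e.2 = j} : ℝ) * (s j - s') ≤ #{e ∈ M | e.2 = j} * (s j - s') :=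
    mul_le_mul_of_nonneg_right (hc'.trans hc) (sub_nonneg.2 hs'.le)
  by_contra hnot
  have hne : M' ≠ M := fun h => hnot (h ▸ hij)
  have hlt : mk.tb M M' := mk.Mstar_lt b s M' hMF' (by linarith) hne
  have hlt' : mk.tb M' M := mk.Mstar_lt _ _ M hMF (by linarith) hne.symm
  exact mk.tb_irrefl M hMF (mk.tb_trans M hMF M' hMF' M hMF hlt hlt')
end
end

section
/- Fix the bids b_{-i} of all buyers other than i and the bids s of all sellers. Suppose that for some bid b_i, buyer i is matched in M*((b_i, b_{-i}), s) to a seller j*. Then for every other bid b'_i, if buyer i is matched to some seller in M*((b'_i, b_{-i}), s), that seller must be j*. -/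
open Finset

noncomputable section

/-- Changing the bid of a matched buyer from `y` to `x` shifts the weight of the matching
by `x - y`, whoever the buyer's partner is. -/
theorem matchWeight_update_sub_matchWeight_update {m n : ℕ} (b : Fin m → ℝ) (s : Fin n → ℝ)
    (i : Fin m) (x y : ℝ) {M : Finset (Fin m × Fin n)} (hM : IsMatching M) {j : Fin n}
    (hj : (i, j) ∈ M) :
    matchWeight (Function.update b i x) s M - matchWeight (Function.update b i y) s M =
      x - y := by
  unfold matchWeight
  rw [← Finset.sum_sub_distrib, Finset.sum_eq_single_of_mem _ hj]
  · simp
  · intro e he hne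
    simp [Function.update_of_ne (hM e he _ hj hne).1]

/-- The matchings selected at two bid profiles coincide if they have equal weight at both
profiles. -/
theorem MarketSetup.Mstar_eq_of_matchWeight_eq {m n : ℕ} (mk : MarketSetup m n)
    {b b' : Fin m → ℝ} {s s' : Fin n → ℝ}
    (h : matchWeight b s (mk.Mstar b' s') = matchWeight b s (mk.Mstar b s))
    (h' : matchWeight b' s' (mk.Mstar b s) = matchWeight b' s' (mk.Mstar b' s')) :
    mk.Mstar b s = mk.Mstar b' s' := by
  by_contra hne
  have hm := mk.Mstar_mem b s
  have hm' := mk.Mstar_mem b' s'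
  exact mk.tb_irrefl _ hm (mk.tb_trans _ hm _ hm' _ hm
    (mk.Mstar_lt b s _ hm' h (Ne.symm hne)) (mk.Mstar_lt b' s' _ hm h' hne))

/-- Fixing `b₋ᵢ` and `s`, if buyer `i` is matched to seller `j*` in
`M*((bᵢ, b₋ᵢ), s)` for some bid `bᵢ`, then for every other bid `b'ᵢ`, whenever buyer `i`
is matched to some seller `j'` in `M*((b'ᵢ, b₋ᵢ), s)`, that seller is `j*`. -/
theorem buyer_partner_stable {m n : ℕ} (mk : MarketSetup m n)
    (b : Fin m → ℝ) (s : Fin n → ℝ) (i : Fin m)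
    (bi bi' : ℝ) (jstar j' : Fin n)
    (hj : (i, jstar) ∈ mk.Mstar (Function.update b i bi) s)
    (hj' : (i, j') ∈ mk.Mstar (Function.update b i bi') s) :
    j' = jstar := by
  have hM := mk.Mstar_mem (Function.update b i bi) s
  have hM' := mk.Mstar_mem (Function.update b i bi') s
  have hmax := mk.Mstar_max (Function.update b i bi) s _ hM'
  have hmax' := mk.Mstar_max (Function.update b i bi') s _ hM
  have hshift := matchWeight_update_sub_matchWeight_update b s i bi bi' (mk.matching _ hM) hj
  have hshift' := matchWeight_update_sub_matchWeight_update b s i bi bi' (mk.matching _ hM') hj'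
  have heq : mk.Mstar (Function.update b i bi) s = mk.Mstar (Function.update b i bi') s :=
    mk.Mstar_eq_of_matchWeight_eq (by linarith) (by linarith)
  rw [← heq] at hj'
  by_contra hne
  exact (mk.matching _ hM _ hj' _ hj (by simp [hne])).1 rfl
end
end

section
/- Fix (i,j) ∈ E, the bids b_{-i} of all buyers other than i, and the costs c_{-j} of all sellers other than j. For any two reported values b_i ≤ b'_i of buyer i, the set {c ∈ ℝ : (i,j) ∈ M*((b_i, b_{-i}), (c, c_{-j}))} is contained in the set {c ∈ ℝ : (i,j) ∈ M*((b'_i, b_{-i}), (c, c_{-j}))}; consequently the critical costs satisfy c̄_ij((b_i, b_{-i}), c_{-j}) ≤ c̄_ij((b'_i, b_{-i}), c_{-j}) in ℝ ∪ {−∞,+∞}. -/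
open Finset

noncomputable section

/-- The set of costs `c` of seller `j` for which `(i,j)` lies in the maximum-weight
matching `M*(b, (c, s₋ⱼ))`. -/
def critSet {m n : ℕ} (mk : MarketSetup m n) (i : Fin m) (j : Fin n)
    (b : Fin m → ℝ) (s : Fin n → ℝ) : Set ℝ :=
  {c : ℝ | (i, j) ∈ mk.Mstar b (Function.update s j c)}

/-- The critical cost `c̄_ij(b, s₋ⱼ) = sup {c ∈ ℝ : (i,j) ∈ M*(b, (c, s₋ⱼ))}`,
taken in the extended reals, with `sup ∅ = −∞`. -/
def critCost {m n : ℕ} (mk : MarketSetup m n) (i : Fin m) (j : Fin n)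
    (b : Fin m → ℝ) (s : Fin n → ℝ) : EReal :=
  sSup ((fun x : ℝ => (x : EReal)) '' critSet mk i j b s)

/-- Changing buyer `i`'s bid from `x` to `y` changes the weight of `M` by `y - x` for each edge
of `M` at `i`. -/
theorem matchWeight_update_buyer {m n : ℕ} (b : Fin m → ℝ) (s : Fin n → ℝ)
    (M : Finset (Fin m × Fin n)) (i : Fin m) (x y : ℝ) :
    matchWeight (Function.update b i y) s M =
      matchWeight (Function.update b i x) s M + #{e ∈ M | e.1 = i} * (y - x) := by
  rw [← nsmul_eq_mul, ← sum_const, sum_filter, matchWeight, matchWeight, ← sum_add_distrib]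
  refine sum_congr rfl fun e _ => ?_
  by_cases h : e.1 = i
  · simp [h]
  · simp [h]

theorem IsMatching.card_filter_fst_le_one {m n : ℕ} {M : Finset (Fin m × Fin n)}
    (hM : IsMatching M) (i : Fin m) : #{e ∈ M | e.1 = i} ≤ 1 := by
  refine card_le_one.2 fun e he e' he' => ?_
  rw [mem_filter] at he he'
  by_contra hne
  exact (hM e he.1 e' he'.1 hne).1 (he.2.trans he'.2.symm)

/-- If the selected matching covers buyer `i`, it is still selected after `i` raises the bid. -/
theorem MarketSetup.Mstar_update_buyer_eq {m n : ℕ} (mk : MarketSetup m n) {i : Fin m} {j : Fin n}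
    {b : Fin m → ℝ} {s : Fin n → ℝ} {x y : ℝ} (hxy : x ≤ y)
    (h : (i, j) ∈ mk.Mstar (Function.update b i x) s) :
    mk.Mstar (Function.update b i y) s = mk.Mstar (Function.update b i x) s := by
  have hmax := mk.Mstar_max (Function.update b i x) s _ (mk.Mstar_mem (Function.update b i y) s)
  have hmax' := mk.Mstar_max (Function.update b i y) s _ (mk.Mstar_mem (Function.update b i x) s)
  have hlt := mk.Mstar_lt (Function.update b i x) s _ (mk.Mstar_mem (Function.update b i y) s)
  have hlt' := mk.Mstar_lt (Function.update b i y) s _ (mk.Mstar_mem (Function.update b i x) s)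
  have hM := mk.Mstar_mem (Function.update b i x) s
  have hM' := mk.Mstar_mem (Function.update b i y) s
  generalize mk.Mstar (Function.update b i x) s = M at *
  generalize mk.Mstar (Function.update b i y) s = M' at *
  have hcard : #{e ∈ M | e.1 = i} = 1 :=
    le_antisymm ((mk.matching M hM).card_filter_fst_le_one i)
      (card_pos.2 ⟨(i, j), mem_filter.2 ⟨h, rfl⟩⟩)
  have hcard' : (#{e ∈ M' | e.1 = i} : ℝ) ≤ 1 := by
    exact_mod_cast (mk.matching M' hM').card_filter_fst_le_one i
  have hw := matchWeight_update_buyer b s M i x y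
  have hw' := matchWeight_update_buyer b s M' i x y
  rw [hcard, Nat.cast_one, one_mul] at hw
  have hgain := mul_le_mul_of_nonneg_right hcard' (sub_nonneg.2 hxy)
  by_contra hne
  exact mk.tb_irrefl M hM (mk.tb_trans M hM M' hM' M hM (hlt (by linarith) hne)
    (hlt' (by linarith) (Ne.symm hne)))

/-- Fixing `(i,j) ∈ E`, `b₋ᵢ` and `c₋ⱼ`, for any two reported values
`bᵢ ≤ b'ᵢ` of buyer `i`, the set of costs for which `(i,j)` is in the maximum-weight
matching only grows, and hence the critical cost is monotone:
`c̄_ij((bᵢ,b₋ᵢ), c₋ⱼ) ≤ c̄_ij((b'ᵢ,b₋ᵢ), c₋ⱼ)`. -/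
theorem critCost_monotone_in_buyer_bid {m n : ℕ} (mk : MarketSetup m n)
    (i : Fin m) (j : Fin n) (hE : (i, j) ∈ mk.E)
    (b : Fin m → ℝ) (c : Fin n → ℝ)
    (bi bi' : ℝ) (hb : bi ≤ bi') :
    critSet mk i j (Function.update b i bi) c ⊆
      critSet mk i j (Function.update b i bi') c ∧
    critCost mk i j (Function.update b i bi) c ≤
      critCost mk i j (Function.update b i bi') c := by
  have hsub : critSet mk i j (Function.update b i bi) c ⊆
      critSet mk i j (Function.update b i bi') c := fun x hx => by
    rw [critSet, Set.mem_ofPred_eq] at hx ⊢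
    rwa [mk.Mstar_update_buyer_eq hb hx]
  exact ⟨hsub, sSup_le_sSup (Set.image_mono hsub)⟩
end
end
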